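/- arXiv:math/0001035 — 2 statements merged into one kernel-verified Lean document; each statement's English description precedes it below -/
import Mathlib

section
/- The set of U-minimal rules is recursive (membership is decidable) if and only if the word problem for (G, A, π) is solvable. -/
/-- The shortlex order on words: `u < v` iff `u` is shorter, or of equal length
and lexicographically smaller. -/
def ShortLexLt {A : Type} [LinearOrder A] (u v : List A) : Prop :=
  u.length < v.length ∨ (u.length = v.length ∧ List.Lex (· < ·) u v)

/-- An elementary `R`-reduction: replace an occurrence of a left-hand side of a rule
of `R` as a subword by the corresponding right-hand side. -/
def ElemRed {A : Type} (R : Set (List A × List A)) (u v : List A) : Prop :=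
  ∃ a b lam rho : List A, (lam, rho) ∈ R ∧ u = a ++ lam ++ b ∧ v = a ++ rho ++ b

/-- A word is `R`-irreducible if no elementary `R`-reduction applies to it. -/
def Irred {A : Type} (R : Set (List A × List A)) (u : List A) : Prop :=
  ¬ ∃ v : List A, ElemRed R u v

/-- The standard assumptions on a set of rules `R`: every rule `(u,v)` satisfies
`u > v` in shortlex and `π u = π v`, and Thue equivalence (the equivalence relation
generated by elementary `R`-reductions) coincides with equality of `π`-images. -/
def StandardAssumptions {A G : Type} [LinearOrder A] (π : List A → G)
    (R : Set (List A × List A)) : Prop :=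
  (∀ p ∈ R, ShortLexLt p.2 p.1 ∧ π p.1 = π p.2) ∧
  (∀ u v : List A, Relation.EqvGen (ElemRed R) u v ↔ π u = π v)

/-- `R` is confluent if all `R`-irreducible words obtainable from a given word by
sequences of elementary `R`-reductions are equal. -/
def Confluent {A : Type} (R : Set (List A × List A)) : Prop :=
  ∀ w u v : List A, Relation.ReflTransGen (ElemRed R) w u →
    Relation.ReflTransGen (ElemRed R) w v → Irred R u → Irred R v → u = v

/-- `u` is the shortlex normal form of its `π`-image: it is shortlex-least in its `π`-fiber. -/
def IsShortLexNF {A G : Type} [LinearOrder A] (π : List A → G) (u : List A) : Prop :=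
  ∀ v : List A, π v = π u → u = v ∨ ShortLexLt u v

/-- The universal set of rules: all pairs `(u,v)` with `u > v` in shortlex and `π u = π v`. -/
def URules {A G : Type} [LinearOrder A] (π : List A → G) : Set (List A × List A) :=
  {p | ShortLexLt p.2 p.1 ∧ π p.1 = π p.2}

/-- `s` is a proper (contiguous) subword of `u`. -/
def ProperFactor {A : Type} (s u : List A) : Prop :=
  ∃ a b : List A, u = a ++ s ++ b ∧ a ++ b ≠ []

/-- A rule `(u,v)` is `R`-minimal if `v` is `R`-irreducible and every proper subword
of `u` is `R`-irreducible. -/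
def RMinimal {A : Type} (R : Set (List A × List A)) (p : List A × List A) : Prop :=
  Irred R p.2 ∧ ∀ s : List A, ProperFactor s p.1 → Irred R s

/-- The set of `U`-minimal rules. -/
def UMinRules {A G : Type} [LinearOrder A] (π : List A → G) : Set (List A × List A) :=
  {p | p ∈ URules π ∧ RMinimal (URules π) p}

section Lists

theorem Computable.list_foldl {α β σ : Type*} [Primcodable α] [Primcodable β] [Primcodable σ]
    {f : α → List β} {g : α → σ} {h : α → σ × β → σ}
    (hf : Computable f) (hg : Computable g) (hh : Computable₂ h) :
    Computable fun a => (f a).foldl (fun s b => h a (s, b)) (g a) := by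
  have hstep : Computable₂ fun (a : α) (p : ℕ × σ) =>
      ((f a)[p.1]?.map fun b => h a (p.2, b)).getD p.2 := by
    refine Computable.option_getD (Computable.option_map ?_ ?_)
      (Computable.snd.comp Computable.snd)
    · exact Computable.list_getElem?.comp (hf.comp Computable.fst)
        (Computable.fst.comp Computable.snd)
    · exact hh.comp (Computable.fst.comp Computable.fst)
        (Computable.pair (Computable.snd.comp (Computable.snd.comp Computable.fst))
          Computable.snd)
  refine (Computable.nat_rec (Computable.list_length.comp hf) hg hstep).of_eq fun a => ?_
  have key : ∀ n : ℕ, Nat.rec (motive := fun _ => σ) (g a)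
      (fun y IH => ((f a)[y]?.map fun b => h a (IH, b)).getD IH) n =
        ((f a).take n).foldl (fun s b => h a (s, b)) (g a) := by
    intro n
    induction n with
    | zero => simp
    | succ n ih =>
      change ((f a)[n]?.map fun b => h a (_, b)).getD _ = _
      rw [List.take_add_one, List.foldl_append, ih]
      cases (f a)[n]? <;> simp
  simpa using key (f a).length

theorem foldl_eq_or_lt_of_decreasing {σ β L : Type*} [Preorder L] (m : σ → L) (f : σ → β → σ)
    (hf : ∀ s b, f s b = s ∨ m (f s b) < m s) (l : List β) (s : σ) :
    l.foldl f s = s ∨ m (l.foldl f s) < m s := by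
  induction l generalizing s with
  | nil => exact Or.inl rfl
  | cons b l ih =>
    rw [List.foldl_cons]
    rcases hf s b with h | h
    · rw [h]; exact ih s
    · rcases ih (f s b) with h' | h'
      · exact Or.inr (h'.symm ▸ h)
      · exact Or.inr (h'.trans h)

theorem foldl_lt_of_decreasing {σ β L : Type*} [Preorder L] (m : σ → L) (f : σ → β → σ)
    (hf : ∀ s b, f s b = s ∨ m (f s b) < m s) (l : List β) (s : σ)
    {b : β} (hb : b ∈ l) (hs : f s b ≠ s) : m (l.foldl f s) < m s := by
  induction l with
  | nil => simp at hb
  | cons c l ih =>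
    rw [List.foldl_cons]
    rcases hf s c with h | h
    · rw [h]
      rcases List.mem_cons.1 hb with rfl | hb
      · exact absurd h hs
      · exact ih hb
    · rcases foldl_eq_or_lt_of_decreasing m f hf l (f s c) with h' | h'
      · exact h'.symm ▸ h
      · exact h'.trans h

theorem exists_iterate_succ_eq_of_decreasing {σ L : Type*} [Preorder L] [WellFoundedLT L]
    (m : σ → L) (f : σ → σ) (hf : ∀ s, f s = s ∨ m (f s) < m s) (s : σ) :
    ∃ n, f^[n + 1] s = f^[n] s := by
  induction h : m s using WellFoundedLT.induction generalizing s with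
  | ind x ih =>
    subst h
    rcases hf s with h | h
    · exact ⟨0, h⟩
    · obtain ⟨n, hn⟩ := ih _ h (f s) rfl
      exact ⟨n + 1, hn⟩

theorem foldl_and_eq_true {β : Type*} (p : β → Bool) (l : List β) :
    l.foldl (fun s b => s && p b) true = true ↔ ∀ b ∈ l, p b = true := by
  have key : ∀ c : Bool, l.foldl (fun s b => s && p b) c = true ↔
      c = true ∧ ∀ b ∈ l, p b = true := by
    induction l with
    | nil => simp
    | cons b l ih => intro c; rw [List.foldl_cons, ih]; simp [and_assoc]
  simpa using key true

/-- All pairs of elements of a list. -/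
def listPairs {β : Type} (l : List β) : List (β × β) :=
  l.flatMap fun a => l.map fun b => (a, b)

theorem mem_listPairs {β : Type} {l : List β} {p : β × β} :
    p ∈ listPairs l ↔ p.1 ∈ l ∧ p.2 ∈ l := by
  rcases p with ⟨a, b⟩
  simp [listPairs]

theorem primrec_listPairs {β : Type} [Primcodable β] :
    Primrec (listPairs : List β → List (β × β)) :=
  Primrec.list_flatMap Primrec.id
    (Primrec.list_map Primrec.fst
      (Primrec.pair (Primrec.snd.comp Primrec.fst) Primrec.snd).to₂).to₂

end Lists

section Words

variable {A : Type} [Fintype A]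

variable (A) in
/-- All words of length at most `n`. -/
noncomputable def wordsUpTo (n : ℕ) : List (List A) :=
  Nat.rec [[]] (fun _ l => [] :: l.flatMap fun w => Finset.univ.toList.map fun x => x :: w) n

theorem mem_wordsUpTo {n : ℕ} {w : List A} : w ∈ wordsUpTo A n ↔ w.length ≤ n := by
  induction n generalizing w with
  | zero => simp [wordsUpTo]
  | succ n ih =>
    have : wordsUpTo A (n + 1) =
      [] :: (wordsUpTo A n).flatMap fun w => Finset.univ.toList.map fun x => x :: w := rfl
    rw [this]
    cases w with
    | nil => simp
    | cons x w => simp [ih]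

theorem primrec_wordsUpTo [Primcodable A] : Primrec (wordsUpTo A) := by
  refine Primrec.nat_rec₁ (f := fun _ (l : List (List A)) =>
    [] :: l.flatMap fun w => Finset.univ.toList.map fun x => x :: w) [[]] ?_
  refine Primrec.list_cons.comp (Primrec.const []) (Primrec.list_flatMap Primrec.snd ?_)
  exact Primrec.list_map (Primrec.const _)
    (Primrec.list_cons.comp Primrec.snd (Primrec.snd.comp Primrec.fst)).to₂

variable [LinearOrder A]

/-- The number of letters smaller than `x`. -/
def letterIndex (x : A) : ℕ := (Finset.univ.filter (· < x)).card

theorem letterIndex_lt_card (x : A) : letterIndex x < Fintype.card A :=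
  Finset.card_lt_univ_of_notMem (x := x) (by simp)

theorem letterIndex_strictMono : StrictMono (letterIndex : A → ℕ) := by
  intro x y h
  refine Finset.card_lt_card (Finset.ssubset_iff_of_subset ?_ |>.2 ⟨x, by simpa using h, by simp⟩)
  intro z hz
  simp only [Finset.mem_filter, Finset.mem_univ, true_and] at hz ⊢
  exact hz.trans h

/-- The value of a word read in base `Fintype.card A`, with leading part `n`. -/
def wordValue (n : ℕ) (w : List A) : ℕ :=
  w.foldl (fun n x => n * Fintype.card A + letterIndex x) n

theorem wordValue_append (n : ℕ) (u v : List A) :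
    wordValue n (u ++ v) = wordValue (wordValue n u) v :=
  List.foldl_append

theorem wordValue_lt_iff {u v : List A} (h : u.length = v.length) (n m : ℕ) :
    wordValue n u < wordValue m v ↔ n < m ∨ n = m ∧ List.Lex (· < ·) u v := by
  induction u generalizing v n m with
  | nil =>
    obtain rfl : v = [] := by simpa using h.symm
    simp [wordValue]
  | cons x u ih =>
    cases v with
    | nil => simp at h
    | cons y v =>
      have hx := letterIndex_lt_card x
      have hy := letterIndex_lt_card y
      have hlex : List.Lex (· < ·) (x :: u) (y :: v) ↔
          letterIndex x < letterIndex y ∨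
            letterIndex x = letterIndex y ∧ List.Lex (· < ·) u v := by
        rw [letterIndex_strictMono.lt_iff_lt, letterIndex_strictMono.injective.eq_iff]
        constructor
        · intro hl
          cases hl with
          | rel hl => exact Or.inl hl
          | cons hl => exact Or.inr ⟨rfl, hl⟩
        · rintro (hl | ⟨rfl, hl⟩)
          · exact List.Lex.rel hl
          · exact List.Lex.cons hl
      have hcons := ih (v := v) (by simpa using h) (n * Fintype.card A + letterIndex x)
        (m * Fintype.card A + letterIndex y)
      change wordValue (n * Fintype.card A + letterIndex x) u <
        wordValue (m * Fintype.card A + letterIndex y) v ↔ _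
      rw [hcons, hlex]
      generalize letterIndex x = i at *
      generalize letterIndex y = j at *
      generalize Fintype.card A = K at *
      rcases lt_trichotomy n m with hnm | rfl | hnm
      · have : n * K + i < m * K + j := by nlinarith
        simp [hnm, this]
      · simp
      · have : m * K + j < n * K + i := by nlinarith
        simp [hnm.not_gt, hnm.ne', this.not_gt, this.ne']

/-- The rank of a word: shortlex comparison is comparison of ranks. -/
def shortLexRank (w : List A) : ℕ ×ₗ ℕ := toLex (w.length, wordValue 0 w)

theorem shortLexLt_iff_rank {u v : List A} :
    ShortLexLt u v ↔ shortLexRank u < shortLexRank v := by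
  rw [shortLexRank, shortLexRank, Prod.Lex.toLex_lt_toLex]
  refine or_congr Iff.rfl (and_congr_right fun h => ?_)
  rw [wordValue_lt_iff h]
  simp

theorem ShortLexLt.append {u v : List A} (h : ShortLexLt u v) (a b : List A) :
    ShortLexLt (a ++ u ++ b) (a ++ v ++ b) := by
  rcases h with h | ⟨hl, h⟩
  · left; simpa using h
  · rw [shortLexLt_iff_rank, shortLexRank, shortLexRank, Prod.Lex.toLex_lt_toLex]
    refine Or.inr ⟨by simp [hl], ?_⟩
    simp only [wordValue_append]
    rw [wordValue_lt_iff rfl, wordValue_lt_iff hl]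
    exact Or.inl (Or.inr ⟨rfl, h⟩)

omit [Fintype A] in
theorem ShortLexLt.length_le {u v : List A} (h : ShortLexLt u v) : u.length ≤ v.length := by
  rcases h with h | h
  · exact h.le
  · exact h.1.le

theorem primrecRel_shortLexLt [Primcodable A] :
    PrimrecRel (ShortLexLt : List A → List A → Prop) := by
  have hval : Primrec (wordValue 0 : List A → ℕ) :=
    Primrec.list_foldl (h := fun _ p => p.1 * Fintype.card A + letterIndex p.2)
      Primrec.id (Primrec.const 0)
      (Primrec.nat_add.comp
        (Primrec.nat_mul.comp (Primrec.fst.comp Primrec.snd) (Primrec.const _))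
        ((Primrec.dom_finite _).comp (Primrec.snd.comp Primrec.snd))).to₂
  have hlen : Primrec (List.length : List A → ℕ) := Primrec.list_length
  have h1 : PrimrecPred fun p : List A × List A => p.1.length < p.2.length :=
    Primrec.nat_lt.comp (hlen.comp Primrec.fst) (hlen.comp Primrec.snd)
  have h2 : PrimrecPred fun p : List A × List A => p.1.length = p.2.length :=
    Primrec.eq.comp (hlen.comp Primrec.fst) (hlen.comp Primrec.snd)
  have h3 : PrimrecPred fun p : List A × List A => wordValue 0 p.1 < wordValue 0 p.2 :=
    Primrec.nat_lt.comp (hval.comp Primrec.fst) (hval.comp Primrec.snd)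
  refine (h1.or (h2.and h3)).of_eq fun p => ?_
  rw [shortLexLt_iff_rank, shortLexRank, shortLexRank, Prod.Lex.toLex_lt_toLex]

end Words

section Rules

variable {A G : Type} [Fintype A] [LinearOrder A] [Group G] {π : List A → G}

theorem irred_URules_iff (hπ_mul : ∀ u v : List A, π (u ++ v) = π u * π v) {w : List A} :
    Irred (URules π) w ↔ ∀ v, π v = π w → ¬ ShortLexLt v w := by
  constructor
  · intro h v hv hlt
    exact h ⟨v, [], [], w, v, ⟨hlt, hv.symm⟩, by simp, by simp⟩
  · rintro h ⟨v, a, b, lam, rho, ⟨hlt, hr⟩, rfl, rfl⟩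
    refine h (a ++ rho ++ b) ?_ (ShortLexLt.append hlt a b)
    have hr : π lam = π rho := hr
    simp only [hπ_mul, hr]

theorem Irred.of_append {A : Type} {R : Set (List A × List A)} {a s b : List A}
    (h : Irred R (a ++ s ++ b)) : Irred R s := by
  rintro ⟨v, c, d, lam, rho, hr, rfl, rfl⟩
  exact h ⟨_, a ++ c, d ++ b, lam, rho, hr, by simp, rfl⟩

theorem exists_irred_of_not_irred (hπ_mul : ∀ u v : List A, π (u ++ v) = π u * π v)
    {w : List A} (h : ¬ Irred (URules π) w) :
    ∃ v, (w, v) ∈ URules π ∧ Irred (URules π) v := by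
  rw [irred_URules_iff hπ_mul] at h
  push Not at h
  obtain ⟨v, hv, hlt⟩ := h
  obtain ⟨r, hr, hmin⟩ := (InvImage.wf shortLexRank wellFounded_lt).has_min
    {r : List A | π r = π w} ⟨v, hv⟩
  have hr : π r = π w := hr
  refine ⟨r, ⟨?_, hr.symm⟩, ?_⟩
  · rw [shortLexLt_iff_rank] at hlt ⊢
    exact lt_of_le_of_lt (not_lt.1 (hmin v hv)) hlt
  · rw [irred_URules_iff hπ_mul]
    intro x hx hxr
    exact hmin x (hx.trans hr) (shortLexLt_iff_rank.1 hxr)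

/-- A reducible word contains the left-hand side of a minimal rule. -/
theorem exists_factor_mem_UMinRules (hπ_mul : ∀ u v : List A, π (u ++ v) = π u * π v)
    {w : List A} (h : ¬ Irred (URules π) w) :
    ∃ a lam b rho, w = a ++ lam ++ b ∧ (lam, rho) ∈ UMinRules π := by
  induction hn : w.length using Nat.strong_induction_on generalizing w with
  | _ n ih =>
    subst hn
    by_cases hp : ∀ s, ProperFactor s w → Irred (URules π) s
    · obtain ⟨r, hr, hirr⟩ := exists_irred_of_not_irred hπ_mul h
      exact ⟨[], w, [], r, by simp, hr, hirr, hp⟩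
    · push Not at hp
      obtain ⟨s, ⟨a, b, rfl, hab⟩, hs⟩ := hp
      have hpos : 0 < (a ++ b).length := List.length_pos_iff.2 hab
      obtain ⟨c, lam, d, rho, rfl, hmem⟩ := ih s.length
        (by simp only [List.length_append] at hpos ⊢; omega) hs rfl
      exact ⟨a ++ c, lam, d ++ b, rho, by simp, hmem⟩

theorem forall_properFactor_irred_iff {A : Type} {R : Set (List A × List A)} {u : List A}
    (hu : u ≠ []) :
    (∀ s, ProperFactor s u → Irred R s) ↔ Irred R u.tail ∧ Irred R u.dropLast := by
  constructor
  · intro h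
    refine ⟨h _ ⟨[u.head hu], [], by simp, by simp⟩,
      h _ ⟨[], [u.getLast hu], by simp [List.dropLast_append_getLast], by simp⟩⟩
  · rintro ⟨ht, hd⟩ s ⟨a, b, rfl, hab⟩
    cases a with
    | cons x a => exact Irred.of_append (a := a) (b := b) (by simpa using ht)
    | nil =>
      have hb : b ≠ [] := by simpa using hab
      refine Irred.of_append (a := []) (b := b.dropLast) ?_
      simpa [List.dropLast_append_of_ne_nil hb] using hd

theorem eq_nil_of_irred_of_map_eq_one (hπ_nil : π [] = 1)
    (hπ_mul : ∀ u v : List A, π (u ++ v) = π u * π v)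
    {w : List A} (h : Irred (URules π) w) (hw : π w = 1) : w = [] := by
  by_contra hne
  exact (irred_URules_iff hπ_mul).1 h [] (hπ_nil.trans hw.symm)
    (Or.inl (List.length_pos_iff.2 hne))

/-- Apply the rule `q.2` to `w` in the context `q.1`, if it is accepted by `f` and applicable. -/
def applyRule (f : List A × List A → Bool) (w : List A)
    (q : (List A × List A) × (List A × List A)) : List A :=
  bif decide (w = q.1.1 ++ q.2.1 ++ q.1.2) && f q.2 then q.1.1 ++ q.2.2 ++ q.1.2 else w

/-- Apply successively all possible rules with contexts and sides no longer than `w`. -/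
noncomputable def reduceStep (f : List A × List A → Bool) (w : List A) : List A :=
  (listPairs (listPairs (wordsUpTo A w.length))).foldl (applyRule f) w

theorem computable_reduceStep [Primcodable A] {f : List A × List A → Bool} (hf : Computable f) :
    Computable (reduceStep f) := by
  have happ (g : List A × ((List A × List A) × (List A × List A)) → List A)
      (hg : Computable g) : Computable
      fun p : List A × ((List A × List A) × (List A × List A)) => p.2.1.1 ++ g p ++ p.2.1.2 :=
    Computable.list_append.comp (Computable.list_append.comp
      (Computable.fst.comp (Computable.fst.comp Computable.snd)) hg)
      (Computable.snd.comp (Computable.fst.comp Computable.snd))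
  have hrule : Computable
      fun p : List A × ((List A × List A) × (List A × List A)) => applyRule f p.1 p.2 := by
    refine Computable.cond (Primrec.and.to_comp.comp ?_ ?_)
      (happ _ (Computable.snd.comp (Computable.snd.comp Computable.snd))) Computable.fst
    · exact (Primrec.eq (α := List A)).decide.to_comp.comp Computable.fst
        (happ _ (Computable.fst.comp (Computable.snd.comp Computable.snd)))
    · exact hf.comp (Computable.snd.comp Computable.snd)
  exact Computable.list_foldl (h := fun _ p => applyRule f p.1 p.2)
    ((primrec_listPairs.comp (primrec_listPairs.comp
      (primrec_wordsUpTo.comp Primrec.list_length))).to_comp) Computable.id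
    (hrule.comp Computable.snd).to₂

omit [Group G] in
theorem applyRule_eq_or_lt {f : List A × List A → Bool}
    (hf : ∀ p, f p = true → p ∈ URules π) (w : List A)
    (q : (List A × List A) × (List A × List A)) :
    applyRule f w q = w ∨ shortLexRank (applyRule f w q) < shortLexRank w := by
  rw [applyRule]
  cases h : decide (w = q.1.1 ++ q.2.1 ++ q.1.2) && f q.2 with
  | false => exact Or.inl rfl
  | true =>
    right
    simp only [Bool.and_eq_true, decide_eq_true_eq] at h
    obtain ⟨rfl, h⟩ := h
    exact shortLexLt_iff_rank.1 ((hf _ h).1.append _ _)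

omit [Fintype A] in
theorem map_applyRule (hπ_mul : ∀ u v : List A, π (u ++ v) = π u * π v)
    {f : List A × List A → Bool} (hf : ∀ p, f p = true → p ∈ URules π) (w : List A)
    (q : (List A × List A) × (List A × List A)) : π (applyRule f w q) = π w := by
  rw [applyRule]
  cases h : decide (w = q.1.1 ++ q.2.1 ++ q.1.2) && f q.2 with
  | false => rfl
  | true =>
    simp only [Bool.and_eq_true, decide_eq_true_eq] at h
    obtain ⟨rfl, h⟩ := h
    simp only [cond_true, hπ_mul, (hf _ h).2]

theorem map_reduceStep (hπ_mul : ∀ u v : List A, π (u ++ v) = π u * π v)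
    {f : List A × List A → Bool} (hf : ∀ p, f p = true → p ∈ URules π) (w : List A) :
    π (reduceStep f w) = π w := by
  rw [reduceStep]
  generalize listPairs (listPairs (wordsUpTo A w.length)) = l
  induction l generalizing w with
  | nil => rfl
  | cons q l ih => rw [List.foldl_cons, ih, map_applyRule hπ_mul hf]

theorem irred_of_reduceStep_eq (hπ_mul : ∀ u v : List A, π (u ++ v) = π u * π v)
    {f : List A × List A → Bool} (hf : ∀ p, f p = true ↔ p ∈ UMinRules π) {w : List A}
    (h : reduceStep f w = w) : Irred (URules π) w := by
  by_contra hirr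
  obtain ⟨a, lam, b, rho, rfl, hmem⟩ := exists_factor_mem_UMinRules hπ_mul hirr
  have hlt : ShortLexLt rho lam := hmem.1.1
  have hle := hlt.length_le
  have happ : applyRule f (a ++ lam ++ b) ((a, b), (lam, rho)) = a ++ rho ++ b := by
    simp [applyRule, (hf _).2 hmem]
  refine (foldl_lt_of_decreasing shortLexRank (applyRule f)
    (applyRule_eq_or_lt fun p hp => ((hf p).1 hp).1)
    (listPairs (listPairs (wordsUpTo A (a ++ lam ++ b).length))) (a ++ lam ++ b)
    (b := ((a, b), (lam, rho))) ?_ ?_).ne (congrArg shortLexRank h)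
  · simp only [mem_listPairs, mem_wordsUpTo, List.length_append]
    omega
  · rw [happ]
    intro he
    have := shortLexLt_iff_rank.1 (hlt.append a b)
    rw [he] at this
    exact this.false

theorem computablePred_eq_one_of_UMinRules [Primcodable A] (hπ_nil : π [] = 1)
    (hπ_mul : ∀ u v : List A, π (u ++ v) = π u * π v)
    (h : ComputablePred fun p : List A × List A => p ∈ UMinRules π) :
    ComputablePred fun w : List A => π w = 1 := by
  classical
  obtain ⟨f, hfc, hf⟩ := ComputablePred.computable_iff.1 h
  replace hf : ∀ p, f p = true ↔ p ∈ UMinRules π := fun p => (congrFun hf p).to_iff.symm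
  have hfU : ∀ p, f p = true → p ∈ URules π := fun p hp => ((hf p).1 hp).1
  have hiter : Computable₂ fun (w : List A) (n : ℕ) => (reduceStep f)^[n] w := by
    refine (Computable.nat_rec (h := fun _ p => reduceStep f p.2) Computable.snd Computable.fst
      ((computable_reduceStep hfc).comp (Computable.snd.comp Computable.snd)).to₂).of_eq ?_
    rintro ⟨w, n⟩
    induction n with
    | zero => rfl
    | succ n ih =>
      exact (congrArg (reduceStep f) ih).trans (Function.iterate_succ_apply' _ _ _).symm
  have hfixed : Computable₂ fun (w : List A) (n : ℕ) =>
      decide ((reduceStep f)^[n + 1] w = (reduceStep f)^[n] w) :=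
    (Primrec.eq (α := List A)).decide.to_comp.comp
      (hiter.comp Computable.fst (Computable.succ.comp Computable.snd)) hiter
  have hout : Computable₂ fun (w : List A) (n : ℕ) => decide ((reduceStep f)^[n] w = []) :=
    (Primrec.eq (α := List A)).decide.to_comp.comp hiter (Computable.const [])
  refine ⟨inferInstance, ((Partrec.rfind hfixed.partrec₂).map hout).of_eq_tot fun w => ?_⟩
  obtain ⟨m, hm⟩ := exists_iterate_succ_eq_of_decreasing shortLexRank (reduceStep f)
    (fun s => foldl_eq_or_lt_of_decreasing _ _ (applyRule_eq_or_lt hfU) _ _) w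
  obtain ⟨n, hn, -⟩ := Nat.rfind_min' (m := m)
    (p := fun n => decide ((reduceStep f)^[n + 1] w = (reduceStep f)^[n] w)) (decide_eq_true hm)
  refine (Part.mem_map_iff _).2 ⟨n, hn, ?_⟩
  have hfix : reduceStep f ((reduceStep f)^[n] w) = (reduceStep f)^[n] w := by
    rw [← Function.iterate_succ_apply' (reduceStep f)]
    exact of_decide_eq_true (Part.mem_some_iff.1 (Nat.rfind_spec hn)).symm
  have hπ_iter : π ((reduceStep f)^[n] w) = π w := by
    clear hn hfix
    induction n with
    | zero => rfl
    | succ n ih => rw [Function.iterate_succ_apply', map_reduceStep hπ_mul hfU, ih]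
  rw [decide_eq_decide]
  change _ ↔ π w = 1
  rw [← hπ_iter]
  exact ⟨fun h => h ▸ hπ_nil,
    eq_nil_of_irred_of_map_eq_one hπ_nil hπ_mul (irred_of_reduceStep_eq hπ_mul hf hfix)⟩

omit [Fintype A] [LinearOrder A] in
theorem map_reverse_map_inv (hπ_nil : π [] = 1)
    (hπ_mul : ∀ u v : List A, π (u ++ v) = π u * π v)
    {ι : A → A} (hι_inv : ∀ x : A, π [ι x] = (π [x])⁻¹) (w : List A) :
    π (w.map ι).reverse = (π w)⁻¹ := by
  induction w with
  | nil => simp [hπ_nil]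
  | cons x w ih =>
    rw [List.map_cons, List.reverse_cons, hπ_mul, ih, hι_inv, ← mul_inv_rev, ← hπ_mul]
    rfl

theorem computablePred_UMinRules_of_eq_one [Primcodable A] (hπ_nil : π [] = 1)
    (hπ_mul : ∀ u v : List A, π (u ++ v) = π u * π v)
    {ι : A → A} (hι_inv : ∀ x : A, π [ι x] = (π [x])⁻¹)
    (h : ComputablePred fun w : List A => π w = 1) :
    ComputablePred fun p : List A × List A => p ∈ UMinRules π := by
  obtain ⟨f, hfc, hf⟩ := ComputablePred.computable_iff.1 h
  replace hf : ∀ w, f w = true ↔ π w = 1 := fun w => (congrFun hf w).to_iff.symm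
  obtain ⟨sltDec, hslt⟩ := primrecRel_shortLexLt (A := A)
  let rule : List A × List A → Bool := fun p =>
    @decide (ShortLexLt p.2 p.1) (sltDec (p.2, p.1)) && f (p.1 ++ (p.2.map ι).reverse)
  have hrule : ∀ p, rule p = true ↔ p ∈ URules π := by
    intro p
    simp only [rule, Bool.and_eq_true, decide_eq_true_eq, hf, hπ_mul,
      map_reverse_map_inv hπ_nil hπ_mul hι_inv, mul_inv_eq_one]
    rfl
  have hrulec : Computable rule :=
    Primrec.and.to_comp.comp
      (hslt.to_comp.comp (Computable.pair Computable.snd Computable.fst))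
      (hfc.comp (Computable.list_append.comp Computable.fst
        (Computable.list_reverse.comp
          (Primrec.list_map Primrec.snd ((Primrec.dom_finite ι).comp Primrec.snd).to₂).to_comp)))
  let irr : List A → Bool := fun w =>
    (wordsUpTo A w.length).foldl (fun s v => s && !rule (w, v)) true
  have hirr : ∀ w, irr w = true ↔ Irred (URules π) w := by
    intro w
    simp only [irr]
    rw [foldl_and_eq_true, irred_URules_iff hπ_mul]
    simp only [mem_wordsUpTo, Bool.not_eq_true', ← Bool.not_eq_true, hrule]
    exact ⟨fun h v hv hlt => h v hlt.length_le ⟨hlt, hv.symm⟩,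
      fun h v _ hm => h v hm.2.symm hm.1⟩
  have hirrc : Computable irr :=
    Computable.list_foldl (h := fun w p => p.1 && !rule (w, p.2))
      (primrec_wordsUpTo.comp Primrec.list_length).to_comp (Computable.const true)
      (Primrec.and.to_comp.comp (Computable.fst.comp Computable.snd)
        (Primrec.not.to_comp.comp (hrulec.comp
          (Computable.pair Computable.fst (Computable.snd.comp Computable.snd))))).to₂
  refine ComputablePred.computable_iff.2
    ⟨fun p => rule p && (irr p.2 && (irr p.1.tail && irr p.1.reverse.tail.reverse)), ?_, ?_⟩
  · have htail : Computable (List.tail : List A → List A) := Primrec.list_tail.to_comp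
    exact Primrec.and.to_comp.comp hrulec (Primrec.and.to_comp.comp
      (hirrc.comp Computable.snd) (Primrec.and.to_comp.comp
        (hirrc.comp (htail.comp Computable.fst))
        (hirrc.comp (Computable.list_reverse.comp
          (htail.comp (Computable.list_reverse.comp Computable.fst))))))
  · funext p
    simp only [List.tail_reverse, List.reverse_reverse, Bool.and_eq_true, hirr, hrule, eq_iff_iff]
    refine and_congr_right fun hp => and_congr_right fun _ =>
      forall_properFactor_irred_iff ?_
    intro he
    have hlt : ShortLexLt p.2 p.1 := hp.1
    rw [he] at hlt
    rcases hlt with h | ⟨-, h⟩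
    · simp at h
    · generalize p.2 = v at h
      cases h

end Rules


/-- The set of `U`-minimal rules is recursive iff the word problem
for `(G, A, π)` is solvable. -/
theorem stmt6 {A G : Type} [Fintype A] [LinearOrder A] [Primcodable A] [Group G]
    (π : List A → G) (hπ_nil : π [] = 1)
    (hπ_mul : ∀ u v : List A, π (u ++ v) = π u * π v)
    (hπ_surj : Function.Surjective π)
    (ι : A → A) (hι : Function.Involutive ι)
    (hι_inv : ∀ x : A, π [ι x] = (π [x])⁻¹) :
    ComputablePred (fun p : List A × List A => p ∈ UMinRules π) ↔
      ComputablePred (fun w : List A => π w = 1) := by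
  exact ⟨computablePred_eq_one_of_UMinRules hπ_nil hπ_mul,
    computablePred_UMinRules_of_eq_one hπ_nil hπ_mul hι_inv⟩
end

section
/- Let R be a set of rules satisfying the standard assumptions which is confluent, and suppose every rule of R is R-minimal. Then R is equal to the set of U-minimal rules. -/
theorem List.Lex.append_append_of_length_eq {α : Type*} {r : α → α → Prop} {s t : List α}
    (h : List.Lex r s t) (hlen : s.length = t.length) (b : List α) :
    List.Lex r (s ++ b) (t ++ b) := by
  induction h with
  | nil => simp at hlen
  | cons _ ih => exact .cons (ih (by simpa using hlen))
  | rel h => exact .rel h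

theorem shortLexLt_wellFounded {A : Type} [Finite A] [LinearOrder A] :
    WellFounded (ShortLexLt (A := A)) := by
  have h := List.Shortlex.wf (Finite.wellFounded_of_trans_of_irrefl ((· < ·) : A → A → Prop))
  exact Subrelation.wf (fun hst => List.shortlex_def.mpr hst) h

theorem ShortLexLt.append_append {A : Type} [LinearOrder A] {s t : List A}
    (h : ShortLexLt s t) (a b : List A) : ShortLexLt (a ++ s ++ b) (a ++ t ++ b) := by
  rcases h with h | ⟨hlen, h⟩
  · left
    simpa using h
  · right
    refine ⟨by simp [hlen], ?_⟩
    rw [List.append_assoc, List.append_assoc]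
    exact List.Lex.append_left _ (h.append_append_of_length_eq hlen b) a

theorem ElemRed.mono {A : Type} {R S : Set (List A × List A)} (hRS : R ⊆ S) {u v : List A}
    (h : ElemRed R u v) : ElemRed S u v := by
  obtain ⟨a, b, lam, rho, hmem, hu, hv⟩ := h
  exact ⟨a, b, lam, rho, hRS hmem, hu, hv⟩

theorem elemRed_of_mem {A : Type} {R : Set (List A × List A)} {u v : List A}
    (h : (u, v) ∈ R) : ElemRed R u v :=
  ⟨[], [], u, v, h, by simp, by simp⟩

theorem elemRed_wellFounded {A : Type} [Finite A] [LinearOrder A] {R : Set (List A × List A)}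
    (hR : ∀ p ∈ R, ShortLexLt p.2 p.1) : WellFounded (fun v u => ElemRed R u v) := by
  refine Subrelation.wf ?_ (shortLexLt_wellFounded (A := A))
  rintro v u ⟨a, b, lam, rho, hmem, rfl, rfl⟩
  exact (hR _ hmem).append_append a b

theorem exists_irred_of_wellFounded {A : Type} {R : Set (List A × List A)}
    (hwf : WellFounded (fun v u => ElemRed R u v)) (w : List A) :
    ∃ u, Relation.ReflTransGen (ElemRed R) w u ∧ Irred R u := by
  induction w using hwf.induction with
  | _ w ih =>
    by_cases hw : Irred R w
    · exact ⟨w, .refl, hw⟩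
    · obtain ⟨v, hv⟩ := not_not.mp hw
      obtain ⟨u, hu, hirr⟩ := ih v hv
      exact ⟨u, .head hv hu, hirr⟩

theorem Irred.eq_of_reflTransGen {A : Type} {R : Set (List A × List A)} {u v : List A}
    (hu : Irred R u) (h : Relation.ReflTransGen (ElemRed R) u v) : u = v := by
  rcases h.cases_head with h | ⟨w, hw, -⟩
  · exact h
  · exact absurd ⟨w, hw⟩ hu

theorem Confluent.eq_of_eqvGen {A : Type} {R : Set (List A × List A)} (hconf : Confluent R)
    (hwf : WellFounded (fun v u => ElemRed R u v)) {u v : List A}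
    (h : Relation.EqvGen (ElemRed R) u v) {a b : List A}
    (hua : Relation.ReflTransGen (ElemRed R) u a) (ha : Irred R a)
    (hvb : Relation.ReflTransGen (ElemRed R) v b) (hb : Irred R b) : a = b := by
  induction h generalizing a b with
  | rel u v h => exact hconf u a b hua (.head h hvb) ha hb
  | refl u => exact hconf u a b hua hvb ha hb
  | symm u v _ ih => exact (ih hvb hb hua ha).symm
  | trans u v w _ _ ih₁ ih₂ =>
    obtain ⟨c, hvc, hc⟩ := exists_irred_of_wellFounded hwf v
    exact (ih₁ hua ha hvc hc).trans (ih₂ hvc hc hvb hb)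

theorem map_eq_of_elemRed_uRules {A G : Type} [LinearOrder A] [Mul G] {π : List A → G}
    (hπ_mul : ∀ u v : List A, π (u ++ v) = π u * π v) {u v : List A}
    (h : ElemRed (URules π) u v) : π u = π v := by
  obtain ⟨a, b, lam, rho, hmem, rfl, rfl⟩ := h
  simp only [hπ_mul, show π lam = π rho from hmem.2]

theorem irred_uRules_iff {A G : Type} [Finite A] [LinearOrder A] [Mul G] {π : List A → G}
    (hπ_mul : ∀ u v : List A, π (u ++ v) = π u * π v) {R : Set (List A × List A)}
    (hstd : StandardAssumptions π R) (hconf : Confluent R) (u : List A) :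
    Irred (URules π) u ↔ Irred R u := by
  have hsub : R ⊆ URules π := hstd.1
  have hwf := elemRed_wellFounded fun p hp => (hstd.1 p hp).1
  have hwfU : WellFounded (fun v u => ElemRed (URules π) u v) :=
    elemRed_wellFounded fun p hp => hp.1
  refine ⟨fun h ⟨v, hv⟩ => h ⟨v, hv.mono hsub⟩, fun h ⟨v, hv⟩ => ?_⟩
  obtain ⟨w, hvw, hw⟩ := exists_irred_of_wellFounded hwf v
  obtain rfl : u = w := hconf.eq_of_eqvGen hwf
    ((hstd.2 u v).mpr (map_eq_of_elemRed_uRules hπ_mul hv)) .refl h hvw hw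
  have hcycle : Relation.TransGen (ElemRed (URules π)) u u :=
    .head' hv (Relation.ReflTransGen.mono (fun _ _ h => h.mono hsub) _ _ hvw)
  exact hwfU.transGen.irrefl.irrefl u (Relation.transGen_swap.mpr hcycle)

theorem rMinimal_uRules_iff {A G : Type} [Finite A] [LinearOrder A] [Mul G] {π : List A → G}
    (hπ_mul : ∀ u v : List A, π (u ++ v) = π u * π v) {R : Set (List A × List A)}
    (hstd : StandardAssumptions π R) (hconf : Confluent R) (p : List A × List A) :
    RMinimal (URules π) p ↔ RMinimal R p := by
  simp only [RMinimal, irred_uRules_iff hπ_mul hstd hconf]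

/-- A confluent set of rules satisfying the standard assumptions, all of
whose rules are minimal, is exactly the set of `U`-minimal rules. -/
theorem stmt7 {A G : Type} [Fintype A] [LinearOrder A] [Group G]
    (π : List A → G) (hπ_nil : π [] = 1)
    (hπ_mul : ∀ u v : List A, π (u ++ v) = π u * π v)
    (hπ_surj : Function.Surjective π)
    (ι : A → A) (hι : Function.Involutive ι)
    (hι_inv : ∀ x : A, π [ι x] = (π [x])⁻¹)
    (R : Set (List A × List A))
    (hstd : StandardAssumptions π R) (hconf : Confluent R)
    (hmin : ∀ p ∈ R, RMinimal R p) :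
    R = UMinRules π := by
  ext ⟨u, v⟩
  refine ⟨fun h => ⟨hstd.1 _ h, (rMinimal_uRules_iff hπ_mul hstd hconf _).mpr (hmin _ h)⟩, ?_⟩
  rintro ⟨hU, hUmin⟩
  obtain ⟨hv, hfactor⟩ := (rMinimal_uRules_iff hπ_mul hstd hconf _).mp hUmin
  have hwf := elemRed_wellFounded fun p hp => (hstd.1 p hp).1
  have hu : ¬ Irred R u := fun h =>
    (irred_uRules_iff hπ_mul hstd hconf u).mpr h ⟨v, elemRed_of_mem hU⟩
  obtain ⟨_, a, b, lam, rho, hmem, heq, -⟩ := not_not.mp hu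
  by_cases hab : a ++ b = []
  · obtain ⟨rfl, rfl⟩ := List.append_eq_nil_iff.mp hab
    obtain rfl : u = lam := by simpa using heq
    obtain rfl : v = rho := hconf.eq_of_eqvGen hwf
      ((hstd.2 v rho).mpr (hU.2.symm.trans (hstd.1 _ hmem).2)) .refl hv .refl (hmin _ hmem).1
    exact hmem
  · exact absurd ⟨rho, elemRed_of_mem hmem⟩ (hfactor lam ⟨a, b, heq, hab⟩)
end
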